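/- arXiv:2407.19230 — 2 statements merged into one kernel-verified Lean document; each statement's English description precedes it below -/
import Mathlib

section
/- Let k and n be nonnegative integers, let p_1, p_2, …, p_{k+1} be odd prime numbers with p_i ≢ 1 (mod 8) for each i ∈ {1, …, k+1}, and let j be a nonnegative integer with p_{k+1} ∤ j. Then B_{3,2}( p_1² p_2² ⋯ p_k² p_{k+1}² n + ( p_1² p_2² ⋯ p_k² · p_{k+1} (8j + p_{k+1}) − 1 ) / 8 ) ≡ 0 (mod 3). -/
/-- The number of `t`-regular partitions of `n`, i.e. partitions of `n`
none of whose parts is divisible by `t`. -/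
noncomputable def regularPartitionCount (t n : ℕ) : ℕ :=
  Nat.card {π : n.Partition // ∀ x ∈ π.parts, ¬ t ∣ x}

/-- `B u v n` is the number of `(u,v)`-regular bipartitions of `n`: pairs `(α, β)` of
partitions with `|α| + |β| = n`, `α` being `u`-regular and `β` being `v`-regular. -/
noncomputable def B (u v n : ℕ) : ℕ :=
  ∑ i ∈ Finset.range (n + 1), regularPartitionCount u i * regularPartitionCount v (n - i)

open Finset

theorem prod_one_add_mul_sum_square {R : Type*} [CommRing R] (q : R) (n : ℕ) :
    (∏ i ∈ range n, (1 + q ^ (i + 1))) *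
        (1 + ∑ i ∈ range n, 2 * (-1) ^ (i + 1) * q ^ ((i + 1) ^ 2)) =
      ∑ s ∈ range (n + 1), (-1) ^ s * (∏ i ∈ range s, (1 + q ^ i)) *
        (∏ i ∈ Ico s n, (1 - q ^ (i + 1))) * q ^ (s * (n + 1)) := by
  induction n with
  | zero => simp
  | succ n ih =>
    have telescope : ∀ m ≤ n, ∑ s ∈ range m,
        ((-1) ^ s * (∏ i ∈ range s, (1 + q ^ i)) *
          (∏ i ∈ Ico s (n + 1), (1 - q ^ (i + 1))) * q ^ (s * (n + 1 + 1)) -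
        (1 + q ^ (n + 1)) * ((-1) ^ s * (∏ i ∈ range s, (1 + q ^ i)) *
          (∏ i ∈ Ico s n, (1 - q ^ (i + 1))) * q ^ (s * (n + 1)))) =
        (-1) ^ m * (∏ i ∈ range m, (1 + q ^ i)) *
          (∏ i ∈ Ico m n, (1 - q ^ (i + 1))) * (1 - q ^ m) * q ^ (m * (n + 1)) := by
      intro m
      induction m with
      | zero => simp
      | succ m ihm =>
        intro hm
        rw [sum_range_succ, ihm (by omega), prod_Ico_succ_top (show m ≤ n by omega),
          prod_eq_prod_Ico_succ_bot (show m < n by omega), prod_range_succ]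
        ring
    have h := telescope n le_rfl
    rw [sum_sub_distrib, ← mul_sum] at h
    have two_mul_prod : (∏ i ∈ range n, (1 + q ^ (i + 1))) * 2 =
        ∏ i ∈ range (n + 1), (1 + q ^ i) := by
      rw [prod_range_succ']; norm_num
    rw [sum_range_succ _ n] at ih
    rw [sum_range_succ _ (n + 1), sum_range_succ _ n, sum_range_succ _ n,
      sub_eq_iff_eq_add.mp h, ← add_assoc, mul_add, prod_range_succ _ n, mul_right_comm, ih]
    rw [show ∀ a b c d : R, a * b * (2 * c * d) = (a * 2) * (b * c * d) by intros; ring,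
      two_mul_prod]
    simp only [Ico_self, prod_empty, Nat.Ico_succ_singleton, prod_singleton, prod_range_succ _ n]
    ring

theorem prod_one_sub_mul_sum_triangular {R : Type*} [CommRing R] (q : R) (n : ℕ) :
    (∏ i ∈ range n, (1 - q ^ (2 * i + 1))) * ∑ i ∈ range (2 * n + 1), q ^ (i * (i + 1) / 2) =
      ∑ s ∈ range (n + 1), (∏ i ∈ range s, (1 - q ^ (2 * i + 1))) *
        (∏ i ∈ Ico s n, (1 - q ^ (2 * i + 2))) * q ^ (s * (2 * n + 1)) := by
  induction n with
  | zero => simp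
  | succ n ih =>
    have telescope : ∀ m ≤ n, ∑ s ∈ range m,
        ((∏ i ∈ range s, (1 - q ^ (2 * i + 1))) *
          (∏ i ∈ Ico s (n + 1), (1 - q ^ (2 * i + 2))) * q ^ (s * (2 * (n + 1) + 1)) -
        (1 - q ^ (2 * n + 1)) * ((∏ i ∈ range s, (1 - q ^ (2 * i + 1))) *
          (∏ i ∈ Ico s n, (1 - q ^ (2 * i + 2))) * q ^ (s * (2 * n + 1)))) =
        (∏ i ∈ range m, (1 - q ^ (2 * i + 1))) *
          (∏ i ∈ Ico m n, (1 - q ^ (2 * i + 2))) * (1 - q ^ (2 * m)) * q ^ (m * (2 * n + 1)) := by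
      intro m
      induction m with
      | zero => simp
      | succ m ihm =>
        intro hm
        rw [sum_range_succ, ihm (by omega), prod_Ico_succ_top (show m ≤ n by omega),
          prod_eq_prod_Ico_succ_bot (show m < n by omega), prod_range_succ]
        ring
    have h := telescope n le_rfl
    rw [sum_sub_distrib, ← mul_sum] at h
    rw [sum_range_succ _ n] at ih
    have h₁ : (2 * n + 1) * (2 * n + 1 + 1) / 2 = (2 * n + 1) * (n + 1) :=
      Nat.div_eq_of_eq_mul_left two_pos (by ring)
    have h₂ : (2 * n + 2) * (2 * n + 2 + 1) / 2 = (n + 1) * (2 * n + 3) :=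
      Nat.div_eq_of_eq_mul_left two_pos (by ring)
    rw [sum_range_succ _ (n + 1), sum_range_succ _ n, sub_eq_iff_eq_add.mp h,
      show 2 * (n + 1) + 1 = 2 * n + 1 + 1 + 1 by ring, sum_range_succ, sum_range_succ, h₁, h₂,
      mul_add, mul_add, prod_range_succ _ n, mul_right_comm, ih]
    simp only [Ico_self, prod_empty, Nat.Ico_succ_singleton, prod_singleton]
    ring

theorem prime_dvd_of_dvd_sq_add {d : ℤ} {q : ℕ} [Fact q.Prime]
    (hd : ¬ IsSquare (-d : ZMod q)) {x y : ℤ} (h : (q : ℤ) ∣ x ^ 2 + d * y ^ 2) :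
    (q : ℤ) ∣ x ∧ (q : ℤ) ∣ y := by
  have h0 : (x : ZMod q) ^ 2 + d * (y : ZMod q) ^ 2 = 0 := by
    have := (ZMod.intCast_zmod_eq_zero_iff_dvd _ q).mpr h
    exact_mod_cast this
  have hy : (y : ZMod q) = 0 := by
    by_contra hy
    refine hd ⟨x / y, ?_⟩
    field_simp
    linear_combination -h0
  rw [hy] at h0
  simp only [← ZMod.intCast_zmod_eq_zero_iff_dvd]
  exact ⟨by simpa using h0, hy⟩

theorem sq_add_ne_of_odd_multiplicity {d : ℤ} {q : ℕ} [hq : Fact q.Prime]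
    (hd : ¬ IsSquare (-d : ZMod q)) {c : ℤ} (hc : ¬ (q : ℤ) ∣ c) (a : ℕ) (ha : a ≠ 0) (x y : ℤ) :
    x ^ 2 + d * y ^ 2 ≠ (a : ℤ) ^ 2 * q * c := by
  induction a using Nat.strong_induction_on generalizing x y with
  | _ a ih =>
    intro h
    have hq0 : (q : ℤ) ≠ 0 := by exact_mod_cast hq.out.ne_zero
    have hqp : Prime (q : ℤ) := Nat.prime_iff_prime_int.mp hq.out
    obtain ⟨⟨u, rfl⟩, ⟨v, rfl⟩⟩ := prime_dvd_of_dvd_sq_add hd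
      (show (q : ℤ) ∣ x ^ 2 + d * y ^ 2 from ⟨(a : ℤ) ^ 2 * c, by rw [h]; ring⟩)
    have h1 : (q : ℤ) * (u ^ 2 + d * v ^ 2) = (a : ℤ) ^ 2 * c :=
      mul_left_cancel₀ hq0 (by linear_combination h)
    have h2 : (q : ℤ) ∣ (a : ℤ) :=
      hqp.dvd_of_dvd_pow ((hqp.dvd_or_dvd ⟨_, h1.symm⟩).resolve_right hc)
    obtain ⟨b, rfl⟩ := Int.natCast_dvd_natCast.mp h2
    have hb : b ≠ 0 := by rintro rfl; simp at ha
    refine ih b ?_ hb u v (mul_left_cancel₀ hq0 ?_)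
    · nlinarith [hq.out.two_le, Nat.pos_of_ne_zero hb]
    · push_cast at h1
      linear_combination h1

namespace PowerSeries
open Filter Topology PowerSeries.WithPiTopology

variable {R : Type*} [CommRing R]

theorem tendsto_order_mul_pow {q : R⟦X⟧} (hq : constantCoeff q = 0) (c : ℕ → R⟦X⟧) {e : ℕ → ℕ}
    (he : ∀ i, i ≤ e i) : Tendsto (fun i ↦ (c i * q ^ e i).order) atTop (𝓝 ⊤) := by
  refine ENat.tendsto_nhds_top_iff_natCast_lt.mpr fun n ↦ eventually_atTop.mpr ⟨n + 1, ?_⟩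
  intro m hm
  grw [← le_order_mul, ← le_order_pow_of_constantCoeff_eq_zero _ hq]
  refine lt_add_of_nonneg_of_lt (by simp) ?_
  exact_mod_cast hm.trans (he m)

variable [TopologicalSpace R]

theorem summable_mul_pow {q : R⟦X⟧} (hq : constantCoeff q = 0) (c : ℕ → R⟦X⟧) {e : ℕ → ℕ}
    (he : ∀ i, i ≤ e i) : Summable fun i ↦ c i * q ^ e i :=
  summable_of_tendsto_order_atTop_nhds_top _ (tendsto_order_mul_pow hq c he)

theorem multipliable_one_add_pow {q : R⟦X⟧} (hq : constantCoeff q = 0) {e : ℕ → ℕ}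
    (he : ∀ i, i ≤ e i) : Multipliable fun i ↦ 1 + q ^ e i := by
  simpa using multipliable_one_add_of_tendsto_order_atTop_nhds_top _
    (tendsto_order_mul_pow hq (fun _ ↦ 1) he)

theorem multipliable_one_sub_pow {q : R⟦X⟧} (hq : constantCoeff q = 0) {e : ℕ → ℕ}
    (he : ∀ i, i ≤ e i) : Multipliable fun i ↦ 1 - q ^ e i := by
  simpa [sub_eq_add_neg] using multipliable_one_add_of_tendsto_order_atTop_nhds_top _
    (tendsto_order_mul_pow hq (fun _ ↦ -1) he)

theorem tendsto_zero_of_pow_dvd {q : R⟦X⟧} (hq : constantCoeff q = 0) {f : ℕ → R⟦X⟧}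
    (hf : ∀ n, q ^ n ∣ f n) : Tendsto f atTop (𝓝 0) := by
  rw [tendsto_iff_coeff_tendsto]
  refine fun d ↦ tendsto_atTop_of_eventually_const (i₀ := d + 1) fun n hn ↦ ?_
  have hX : X ^ n ∣ f n := (pow_dvd_pow_of_dvd (X_dvd_iff.mpr hq) n).trans (hf n)
  simpa using X_pow_dvd_iff.mp hX d hn

/-- The series `∑ (-1) ^ i * q ^ (i ^ 2)` over all integers `i`. -/
noncomputable def thetaSquare (q : R⟦X⟧) : R⟦X⟧ :=
  1 + ∑' i : ℕ, 2 * (-1) ^ (i + 1) * q ^ ((i + 1) ^ 2)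

/-- The series `∑ q ^ (i * (i + 1) / 2)` over all natural numbers `i`. -/
noncomputable def thetaTriangular (q : R⟦X⟧) : R⟦X⟧ :=
  ∑' i : ℕ, q ^ (i * (i + 1) / 2)

/-- Euler's product `∏ (1 - q ^ i)` over all positive integers `i`. -/
noncomputable def eulerProd (q : R⟦X⟧) : R⟦X⟧ :=
  ∏' i : ℕ, (1 - q ^ (i + 1))

theorem le_triangular (i : ℕ) : i ≤ i * (i + 1) / 2 := by
  rw [Nat.le_div_iff_mul_le two_pos]
  rcases i with _ | i
  · simp
  · nlinarith

theorem summable_thetaSquare {q : R⟦X⟧} (hq : constantCoeff q = 0) :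
    Summable fun i : ℕ ↦ 2 * (-1) ^ (i + 1) * q ^ ((i + 1) ^ 2) :=
  summable_mul_pow hq _ fun i ↦ by nlinarith

theorem summable_thetaTriangular {q : R⟦X⟧} (hq : constantCoeff q = 0) :
    Summable fun i : ℕ ↦ q ^ (i * (i + 1) / 2) := by
  simpa using summable_mul_pow hq (fun _ ↦ 1) le_triangular

variable [T2Space R]

theorem exists_of_coeff_thetaSquare_ne_zero {q : R⟦X⟧} (hq : constantCoeff q = 0) {k : ℕ}
    (hk : ∀ m n, coeff n (q ^ m) ≠ 0 → n = k * m) {n : ℕ} (hn : coeff n (thetaSquare q) ≠ 0) :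
    ∃ i, n = k * i ^ 2 := by
  contrapose! hn
  have h0 : n ≠ 0 := by simpa using hn 0
  rw [thetaSquare, map_add, (summable_thetaSquare hq).map_tsum _ (continuous_coeff R n)]
  have (i : ℕ) : coeff n (2 * (-1) ^ (i + 1) * q ^ ((i + 1) ^ 2)) = 0 := by
    have h := not_imp_comm.mp (hk ((i + 1) ^ 2) n) (hn (i + 1))
    rcases neg_one_pow_eq_or R⟦X⟧ (i + 1) with h' | h' <;> simp [h', h, two_mul]
  simp [this, coeff_one, h0]

theorem exists_of_coeff_thetaTriangular_ne_zero {q : R⟦X⟧} (hq : constantCoeff q = 0) {k : ℕ}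
    (hk : ∀ m n, coeff n (q ^ m) ≠ 0 → n = k * m) {n : ℕ}
    (hn : coeff n (thetaTriangular q) ≠ 0) : ∃ i, n = k * (i * (i + 1) / 2) := by
  contrapose! hn
  rw [thetaTriangular, (summable_thetaTriangular hq).map_tsum _ (continuous_coeff R n)]
  have (i : ℕ) : coeff n (q ^ (i * (i + 1) / 2)) = 0 := not_imp_comm.mp (hk _ n) (hn i)
  simp [this]

theorem eulerProd_ne_zero [Nontrivial R] {q : R⟦X⟧} (hq : constantCoeff q = 0) :
    eulerProd q ≠ 0 := by
  intro h
  have := congrArg constantCoeff h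
  simp [eulerProd, (multipliable_one_sub_pow hq fun i ↦ Nat.le_add_right i 1).map_tprod _
    (continuous_constantCoeff R), hq] at this

variable [IsTopologicalRing R]

theorem tprod_one_add_pow_mul_thetaSquare {q : R⟦X⟧} (hq : constantCoeff q = 0) :
    (∏' i : ℕ, (1 + q ^ (i + 1))) * thetaSquare q = eulerProd q := by
  have h₁ := (multipliable_one_add_pow hq fun i ↦ Nat.le_add_right i 1).tendsto_prod_tprod_nat.mul
    ((summable_thetaSquare hq).tendsto_sum_tsum_nat.const_add 1)
  have h₂ := (multipliable_one_sub_pow hq fun i ↦ Nat.le_add_right i 1).tendsto_prod_tprod_nat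
  refine sub_eq_zero.mp (tendsto_nhds_unique (h₁.sub h₂) (tendsto_zero_of_pow_dvd hq fun n ↦ ?_))
  rw [prod_one_add_mul_sum_square, sum_range_succ']
  simp only [pow_zero, range_zero, prod_empty, zero_mul, mul_one, one_mul, ← range_eq_Ico,
    add_sub_cancel_right]
  exact dvd_sum fun s _ ↦ dvd_mul_of_dvd_right (pow_dvd_pow _ (by nlinarith)) _

theorem tprod_one_sub_pow_odd_mul_thetaTriangular {q : R⟦X⟧} (hq : constantCoeff q = 0) :
    (∏' i : ℕ, (1 - q ^ (2 * i + 1))) * thetaTriangular q = eulerProd (q ^ 2) := by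
  have h₁ := (multipliable_one_sub_pow hq (e := fun i ↦ 2 * i + 1)
    fun i ↦ by omega).tendsto_prod_tprod_nat.mul
    ((summable_thetaTriangular hq).tendsto_sum_tsum_nat.comp
      (tendsto_atTop_mono (fun n ↦ by omega : ∀ n : ℕ, n ≤ 2 * n + 1) tendsto_id))
  have h₂ := (multipliable_one_sub_pow (q := q ^ 2) (by simp [hq])
    fun i ↦ Nat.le_add_right i 1).tendsto_prod_tprod_nat
  refine sub_eq_zero.mp (tendsto_nhds_unique (h₁.sub h₂) (tendsto_zero_of_pow_dvd hq fun n ↦ ?_))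
  rw [Function.comp_apply, prod_one_sub_mul_sum_triangular, sum_range_succ']
  simp only [pow_zero, range_zero, prod_empty, zero_mul, mul_one, one_mul, ← range_eq_Ico,
    ← pow_mul, mul_add 2, add_sub_cancel_right]
  exact dvd_sum fun s _ ↦ dvd_mul_of_dvd_right (pow_dvd_pow _ (by nlinarith)) _

theorem eulerProd_mul_tprod_one_add_pow {q : R⟦X⟧} (hq : constantCoeff q = 0) :
    eulerProd q * ∏' i : ℕ, (1 + q ^ (i + 1)) = eulerProd (q ^ 2) := by
  rw [eulerProd, ← (multipliable_one_sub_pow hq fun i ↦ Nat.le_add_right i 1).tprod_mul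
    (multipliable_one_add_pow hq fun i ↦ Nat.le_add_right i 1)]
  exact tprod_congr fun i ↦ by ring

theorem tprod_one_sub_pow_odd_mul_eulerProd {q : R⟦X⟧} (hq : constantCoeff q = 0) :
    (∏' i : ℕ, (1 - q ^ (2 * i + 1))) * eulerProd (q ^ 2) = eulerProd q := by
  rw [eulerProd, eulerProd, ← tprod_even_mul_odd (f := fun i ↦ 1 - q ^ (i + 1))
    (multipliable_one_sub_pow hq fun i ↦ by omega) (multipliable_one_sub_pow hq fun i ↦ by omega)]
  simp only [← pow_mul, mul_add, mul_one, add_assoc, one_add_one_eq_two]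

theorem thetaSquare_mul_eulerProd {q : R⟦X⟧} (hq : constantCoeff q = 0) :
    thetaSquare q * eulerProd (q ^ 2) = eulerProd q ^ 2 := by
  linear_combination eulerProd q * tprod_one_add_pow_mul_thetaSquare hq -
    thetaSquare q * eulerProd_mul_tprod_one_add_pow hq

theorem thetaTriangular_mul_eulerProd {q : R⟦X⟧} (hq : constantCoeff q = 0) :
    thetaTriangular q * eulerProd q = eulerProd (q ^ 2) ^ 2 := by
  linear_combination eulerProd (q ^ 2) * tprod_one_sub_pow_odd_mul_thetaTriangular hq -
    thetaTriangular q * tprod_one_sub_pow_odd_mul_eulerProd hq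

theorem eulerProd_mul_eulerProd_neg {q : R⟦X⟧} (hq : constantCoeff q = 0) :
    eulerProd q * eulerProd (-q) * eulerProd (q ^ 4) = eulerProd (q ^ 2) ^ 3 := by
  have hq' : constantCoeff (-q) = 0 := by simp [hq]
  have h : (∏' i : ℕ, (1 - q ^ (2 * i + 1))) * ∏' i : ℕ, (1 - (-q) ^ (2 * i + 1)) =
      ∏' i : ℕ, (1 - (q ^ 2) ^ (2 * i + 1)) := by
    rw [← (multipliable_one_sub_pow hq fun i ↦ by omega).tprod_mul
      (multipliable_one_sub_pow hq' fun i ↦ by omega)]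
    refine tprod_congr fun i ↦ ?_
    rw [Odd.neg_pow ⟨i, rfl⟩]
    ring
  have h₁ := tprod_one_sub_pow_odd_mul_eulerProd hq
  have h₂ := tprod_one_sub_pow_odd_mul_eulerProd hq'
  have h₃ := tprod_one_sub_pow_odd_mul_eulerProd (q := q ^ 2) (by simp [hq])
  rw [neg_sq] at h₂
  rw [← pow_mul, ← h] at h₃
  rw [← h₁, ← h₂]
  linear_combination eulerProd (q ^ 2) ^ 2 * h₃

variable [IsDomain R]

theorem thetaSquare_mul_thetaTriangular {q : R⟦X⟧} (hq : constantCoeff q = 0) :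
    thetaSquare q * thetaTriangular q = eulerProd q * eulerProd (q ^ 2) := by
  refine mul_right_cancel₀ (mul_ne_zero (eulerProd_ne_zero hq)
    (eulerProd_ne_zero (q := q ^ 2) (by simp [hq]))) ?_
  linear_combination thetaTriangular q * eulerProd q * thetaSquare_mul_eulerProd hq +
    eulerProd q ^ 2 * thetaTriangular_mul_eulerProd hq

theorem thetaSquare_sq_mul_thetaTriangular_neg {q : R⟦X⟧} (hq : constantCoeff q = 0) :
    thetaSquare (q ^ 2) * thetaTriangular (-q) = eulerProd q * eulerProd (q ^ 2) := by
  have h₁ := thetaSquare_mul_eulerProd (q := q ^ 2) (by simp [hq])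
  have h₂ := thetaTriangular_mul_eulerProd (q := -q) (by simp [hq])
  rw [← pow_mul] at h₁
  rw [neg_sq] at h₂
  refine mul_right_cancel₀ (mul_ne_zero (eulerProd_ne_zero (q := -q) (by simp [hq]))
    (eulerProd_ne_zero (q := q ^ 4) (by simp [hq]))) ?_
  linear_combination thetaTriangular (-q) * eulerProd (-q) * h₁ +
    eulerProd (q ^ 2) ^ 2 * h₂ - eulerProd (q ^ 2) * eulerProd_mul_eulerProd_neg hq

end PowerSeries

section
open PowerSeries PowerSeries.WithPiTopology

theorem regularPartitionCount_eq_card_countRestricted {t : ℕ} (ht : 0 < t) (n : ℕ) :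
    regularPartitionCount t n = #(Nat.Partition.countRestricted n t) := by
  rw [← Nat.Partition.card_restricted_eq_card_countRestricted n ht, regularPartitionCount,
    Nat.card_eq_fintype_card, Fintype.card_subtype, Nat.Partition.restricted]

variable [TopologicalSpace (ZMod 3)] [T2Space (ZMod 3)]

theorem mk_regularPartitionCount_two :
    (mk fun n ↦ (regularPartitionCount 2 n : ZMod 3)) = ∏' i : ℕ, (1 + X ^ (i + 1)) := by
  simp_rw [regularPartitionCount_eq_card_countRestricted (t := 2) two_pos]
  rw [Nat.Partition.powerSeriesMk_card_countRestricted_eq_tprod _ (m := 2) two_pos]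
  simp [sum_range_succ]

variable [IsTopologicalRing (ZMod 3)]

theorem mk_regularPartitionCount_three :
    (mk fun n ↦ (regularPartitionCount 3 n : ZMod 3)) = eulerProd X ^ 2 := by
  simp_rw [regularPartitionCount_eq_card_countRestricted (t := 3) three_pos]
  rw [Nat.Partition.powerSeriesMk_card_countRestricted_eq_tprod _ (m := 3) three_pos, eulerProd,
    ← (multipliable_one_sub_X_pow (ZMod 3)).tprod_pow]
  refine tprod_congr fun i ↦ ?_
  have h3 : (3 : (ZMod 3)⟦X⟧) = 0 := by
    rw [← map_ofNat (C (R := ZMod 3)) 3, show (OfNat.ofNat 3 : ZMod 3) = 0 from by decide, map_zero]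
  simp only [sum_range_succ, range_zero, sum_empty]
  linear_combination X ^ (i + 1) * h3

theorem cast_B_three_two (n : ℕ) :
    (B 3 2 n : ZMod 3) = coeff n (eulerProd X * eulerProd (X ^ 2) : (ZMod 3)⟦X⟧) := by
  have h : (eulerProd X * eulerProd (X ^ 2) : (ZMod 3)⟦X⟧) =
      (mk fun n ↦ (regularPartitionCount 3 n : ZMod 3)) *
        mk fun n ↦ (regularPartitionCount 2 n : ZMod 3) := by
    rw [mk_regularPartitionCount_two, mk_regularPartitionCount_three,
      ← eulerProd_mul_tprod_one_add_pow (by simp)]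
    ring
  rw [h, coeff_mul, B]
  simp only [coeff_mk]
  rw [Nat.sum_antidiagonal_eq_sum_range_succ
    (fun i j ↦ (regularPartitionCount 3 i : ZMod 3) * regularPartitionCount 2 j)]
  push_cast
  rfl

end

section
open PowerSeries

theorem eight_mul_triangular (i : ℕ) : 8 * (i * (i + 1) / 2) + 1 = (2 * i + 1) ^ 2 := by
  have := Nat.div_mul_cancel (Nat.even_mul_succ_self i).two_dvd
  linarith

theorem exists_sq_add_sq_of_cast_B_ne_zero {n : ℕ} (hn : (B 3 2 n : ZMod 3) ≠ 0) :
    (∃ x y : ℤ, x ^ 2 + 1 * y ^ 2 = 8 * n + 1) ∧ ∃ x y : ℤ, x ^ 2 + 2 * y ^ 2 = 8 * n + 1 := by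
  let _ : TopologicalSpace (ZMod 3) := ⊥
  have _ : DiscreteTopology (ZMod 3) := ⟨rfl⟩
  rw [cast_B_three_two] at hn
  have hX : ∀ m n, coeff n ((X : (ZMod 3)⟦X⟧) ^ m) ≠ 0 → n = 1 * m := fun m n h ↦ by
    simpa [coeff_X_pow] using h
  have hX2 : ∀ m n, coeff n (((X : (ZMod 3)⟦X⟧) ^ 2) ^ m) ≠ 0 → n = 2 * m := fun m n h ↦ by
    simpa [coeff_X_pow, ← pow_mul] using h
  have hnegX : ∀ m n, coeff n ((-X : (ZMod 3)⟦X⟧) ^ m) ≠ 0 → n = 1 * m := fun m n h ↦ by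
    rw [neg_pow] at h
    rcases neg_one_pow_eq_or (ZMod 3)⟦X⟧ m with h' | h' <;> simpa [coeff_X_pow, h'] using h
  constructor
  · rw [← thetaSquare_sq_mul_thetaTriangular_neg (by simp), coeff_mul] at hn
    obtain ⟨⟨a, b⟩, hab, h⟩ := exists_ne_zero_of_sum_ne_zero hn
    obtain ⟨i, rfl⟩ := exists_of_coeff_thetaSquare_ne_zero (by simp) hX2 (left_ne_zero_of_mul h)
    obtain ⟨j, rfl⟩ := exists_of_coeff_thetaTriangular_ne_zero (by simp) hnegX
      (right_ne_zero_of_mul h)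
    refine ⟨2 * j + 1, 4 * i, ?_⟩
    have := eight_mul_triangular j
    rw [HasAntidiagonal.mem_antidiagonal] at hab
    rw [← hab]
    push_cast [← @Nat.cast_inj ℤ] at this ⊢
    linarith
  · rw [← thetaSquare_mul_thetaTriangular (by simp), coeff_mul] at hn
    obtain ⟨⟨a, b⟩, hab, h⟩ := exists_ne_zero_of_sum_ne_zero hn
    obtain ⟨i, rfl⟩ := exists_of_coeff_thetaSquare_ne_zero (by simp) hX (left_ne_zero_of_mul h)
    obtain ⟨j, rfl⟩ := exists_of_coeff_thetaTriangular_ne_zero (by simp) hX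
      (right_ne_zero_of_mul h)
    refine ⟨2 * j + 1, 2 * i, ?_⟩
    have := eight_mul_triangular j
    rw [HasAntidiagonal.mem_antidiagonal] at hab
    rw [← hab]
    push_cast [← @Nat.cast_inj ℤ] at this ⊢
    linarith

end

theorem B_three_two_modEq_zero {n a q c : ℕ} (hq : q.Prime) (hq2 : q ≠ 2) (hq8 : q % 8 ≠ 1)
    (ha : a ≠ 0) (hc : ¬ q ∣ c) (h : 8 * n + 1 = a ^ 2 * q * c) : B 3 2 n ≡ 0 [MOD 3] := by
  have _ : Fact q.Prime := ⟨hq⟩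
  rw [← ZMod.natCast_eq_natCast_iff, Nat.cast_zero]
  by_contra hn
  obtain ⟨⟨x, y, hxy⟩, u, v, huv⟩ := exists_sq_add_sq_of_cast_B_ne_zero hn
  have hc' : ¬ (q : ℤ) ∣ c := by rwa [Int.natCast_dvd_natCast]
  have h' : (8 * n + 1 : ℤ) = (a : ℤ) ^ 2 * q * c := by exact_mod_cast h
  by_cases hq4 : q % 4 = 3
  · refine sq_add_ne_of_odd_multiplicity ?_ hc' a ha x y (hxy.trans h')
    simpa [ZMod.exists_sq_eq_neg_one_iff] using hq4
  · refine sq_add_ne_of_odd_multiplicity ?_ hc' a ha u v (huv.trans h')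
    have := hq.eq_two_or_odd
    simp only [Int.cast_ofNat, ZMod.exists_sq_eq_neg_two_iff hq2]
    omega

/-- Theorem 1.2(iii): congruences modulo 3 for `B 3 2`.  Here `p 0, …, p k` play the role of
`p_1, …, p_{k+1}` in the paper. -/
theorem B_3_2_cong (k n j : ℕ) (p : ℕ → ℕ)
    (hp : ∀ i < k + 1, (p i).Prime ∧ p i ≠ 2 ∧ p i % 8 ≠ 1)
    (hj : ¬ p k ∣ j) :
    B 3 2 ((∏ i ∈ Finset.range (k + 1), (p i) ^ 2) * n
        + ((∏ i ∈ Finset.range k, (p i) ^ 2) * p k * (8 * j + p k) - 1) / 8)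
      ≡ 0 [MOD 3] := by
  obtain ⟨hq, hq2, hq8⟩ := hp k k.lt_succ_self
  have odd_sq (m : ℕ) (hm : Odd m) : ∃ t, m ^ 2 = 8 * t + 1 := by
    obtain ⟨i, rfl⟩ := hm
    exact ⟨_, (eight_mul_triangular i).symm⟩
  set a := ∏ i ∈ range k, p i with ha
  have ha_odd : Odd a := prod_induction _ Odd (fun _ _ ↦ Odd.mul) odd_one fun i hi ↦
    have hi := hp i ((mem_range.mp hi).trans k.lt_succ_self)
    hi.1.odd_of_ne_two hi.2.1
  obtain ⟨s, hs⟩ := odd_sq (a * p k) (ha_odd.mul (hq.odd_of_ne_two hq2))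
  refine B_three_two_modEq_zero (a := a) (c := 8 * (p k * n + j) + p k) hq hq2 hq8
    ha_odd.pos.ne' ?_ ?_
  · intro h
    have h8 : p k ∣ 8 * (p k * n + j) := (Nat.dvd_add_left dvd_rfl).mp h
    have : ¬ p k ∣ 8 := fun h ↦ hq2 ((Nat.prime_dvd_prime_iff_eq hq Nat.prime_two).mp
      (hq.dvd_of_dvd_pow (show p k ∣ 2 ^ 3 from h)))
    exact hj ((Nat.dvd_add_right (dvd_mul_right _ _)).mp ((hq.dvd_mul.mp h8).resolve_left this))
  · rw [prod_range_succ, prod_pow, ← ha]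
    have : a ^ 2 * p k * (8 * j + p k) = 8 * (a ^ 2 * p k * j + s) + 1 := by linarith
    rw [this, Nat.add_sub_cancel, Nat.mul_div_cancel_left _ (by norm_num)]
    linarith
end

section
/- Let p be a prime number with p ≡ 1 (mod 4) and suppose B_{3,5}((p−1)/4) ≡ 0 (mod 3). Then for every nonnegative integer α and every nonnegative integer n with p ∤ (4n+1), we have B_{3,5}( p^{2α+1} n + (p^{2α+1} − 1)/4 ) ≡ 0 (mod 3). -/
open PowerSeries PowerSeries.WithPiTopology

/-- The generating function of `t`-regular partitions. -/
noncomputable def regularPartitionSeries (R : Type*) [CommRing R] (t : ℕ) : R⟦X⟧ :=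
  PowerSeries.mk fun n ↦ (regularPartitionCount t n : R)

theorem regularPartitionCount_eq_card_restricted (t n : ℕ) :
    regularPartitionCount t n = (Nat.Partition.restricted n (¬ t ∣ ·)).card := by
  rw [regularPartitionCount, Nat.card_eq_fintype_card, Fintype.card_subtype,
    Nat.Partition.restricted]

theorem hasProd_expand_pentagonalSeries (R : Type*) [CommRing R] [TopologicalSpace R]
    {m : ℕ} (hm : m ≠ 0) :
    HasProd (fun i ↦ (1 - X ^ ((i + 1) * m) : R⟦X⟧)) (expand m hm (pentagonalSeries R)) := by
  have key (s : Finset ℕ) : ∏ i ∈ s, (1 - X ^ ((i + 1) * m) : R⟦X⟧) =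
      expand m hm (∏ i ∈ s, (1 - X ^ (i + 1) : R⟦X⟧)) := by
    simp [map_prod, ← pow_mul, mul_comm]
  rw [HasProd, tendsto_iff_coeff_tendsto]
  intro n
  apply tendsto_nhds_of_eventually_eq
  simp only [key, coeff_expand]
  split_ifs with h
  · simpa using coeff_prod_one_sub_X_pow_eventually_eq R (n / m)
  · simp

theorem regularPartitionSeries_mul_pentagonalSeries (R : Type*) [CommRing R] [NoZeroDivisors R]
    {m : ℕ} (hm : m ≠ 0) :
    regularPartitionSeries R m * pentagonalSeries R = expand m hm (pentagonalSeries R) := by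
  nontriviality R
  let _ : TopologicalSpace R := ⊥
  have _ : DiscreteTopology R := ⟨rfl⟩
  have h := (Nat.Partition.hasProd_powerSeriesMk_card_restricted R (¬ m ∣ ·)).mul
    (hasProd_one_sub_X_pow R)
  simp_rw [regularPartitionSeries, regularPartitionCount_eq_card_restricted]
  rw [← h.tprod_eq, ← (hasProd_expand_pentagonalSeries R hm).tprod_eq]
  simp_rw [ite_not, ite_mul, pow_mul]
  conv_lhs =>
    congr
    ext b
    rw [tsum_pow_mul_one_sub_of_constantCoeff_eq_zero (by simp)]
  refine tprod_eq_tprod_of_ne_one_bij (fun i ↦ (i.val + 1) * m - 1) ?_ ?_ ?_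
  · intro a b h
    have hm' : 0 < m := Nat.pos_of_ne_zero hm
    rw [tsub_left_inj (by nlinarith) (by nlinarith), mul_left_inj' hm, add_left_inj] at h
    exact SetCoe.ext h
  · suffices ∀ (i : ℕ), m ∣ i + 1 → ∃ j ≠ 0, j * m - 1 = i by simpa
    intro i hi
    obtain ⟨j, hj⟩ := dvd_def.mp hi
    refine ⟨j, by grind, Nat.sub_eq_of_eq_add ?_⟩
    rw [hj, mul_comm m j]
  · intro i
    have : (i + 1) * m - 1 + 1 = (i + 1) * m := by
      have := Nat.pos_of_ne_zero hm
      have : 0 < (i + 1) * m := by positivity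
      omega
    simp [this, pow_mul]

theorem expand_pentagonalSeries_eq_pow (R : Type*) [CommRing R] (q : ℕ) [Fact q.Prime]
    [CharP R q] :
    expand q (Fact.out : q.Prime).ne_zero (pentagonalSeries R) = pentagonalSeries R ^ q := by
  let _ : TopologicalSpace R := ⊥
  have _ : DiscreteTopology R := ⟨rfl⟩
  have h := (hasProd_one_sub_X_pow R).map (powMonoidHom q) (continuous_pow q)
  refine (hasProd_expand_pentagonalSeries R _).unique ?_
  convert h using 2 with i
  · have : CharP R⟦X⟧ q := charP_of_injective_ringHom (f := C (R := R)) C_injective q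
    simp [sub_pow_expChar, pow_mul]
  · rfl

theorem cast_B (R : Type*) [CommRing R] (u v n : ℕ) :
    (B u v n : R) = coeff n (regularPartitionSeries R u * regularPartitionSeries R v) := by
  rw [coeff_mul, Finset.Nat.sum_antidiagonal_eq_sum_range_succ_mk, B]
  simp [regularPartitionSeries]

theorem cast_B_three (v n : ℕ) (hv : v ≠ 0) :
    (B 3 v n : ZMod 3) =
      coeff n (pentagonalSeries (ZMod 3) * expand v hv (pentagonalSeries (ZMod 3))) := by
  have h0 : pentagonalSeries (ZMod 3) ≠ 0 := by
    intro h
    have := coeff_pentagonalSeries_pentagonal (ZMod 3) 0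
    simp [h] at this
  have h3 : regularPartitionSeries (ZMod 3) 3 = pentagonalSeries (ZMod 3) ^ 2 := by
    apply mul_right_cancel₀ h0
    rw [regularPartitionSeries_mul_pentagonalSeries _ three_ne_zero,
      expand_pentagonalSeries_eq_pow (ZMod 3) 3]
    ring
  rw [cast_B, h3, ← regularPartitionSeries_mul_pentagonalSeries]
  congr 1
  ring

/-- The even character modulo `12` on integers coprime to `12`. -/
def twelveSign (a : ℤ) : ℤ := if a % 12 = 1 ∨ a % 12 = 11 then 1 else -1

theorem exists_sq_of_coeff_pentagonalSeries_ne_zero {R : Type*} [CommRing R] {i : ℕ}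
    (h : (pentagonalSeries R).coeff i ≠ 0) : ∃ x : ℤ, 24 * (i : ℤ) + 1 = x ^ 2 := by
  by_cases hi : i ∈ Set.range pentagonal
  · obtain ⟨k, rfl⟩ := hi
    exact ⟨6 * k - 1, by linear_combination 12 * two_mul_natCast_pentagonal k⟩
  · exact absurd (coeff_pentagonalSeries_eq_zero R hi) h

theorem coeff_pentagonalSeries_of_sq (R : Type*) [CommRing R] {i : ℕ} {a : ℤ}
    (h : 24 * (i : ℤ) + 1 = a ^ 2) : (pentagonalSeries R).coeff i = twelveSign a := by
  have h6 : a % 6 = 1 ∨ a % 6 = 5 := by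
    have h' : a ^ 2 % 6 = 1 := by omega
    have : a % 6 = 0 ∨ a % 6 = 1 ∨ a % 6 = 2 ∨ a % 6 = 3 ∨ a % 6 = 4 ∨ a % 6 = 5 := by omega
    rcases this with h | h | h | h | h | h <;> simp [pow_two, Int.mul_emod, h] at h' ⊢
  obtain ⟨k, hk⟩ : ∃ k, a = 6 * k - 1 ∨ a = -(6 * k - 1) := by
    rcases h6 with h6 | h6
    · exact ⟨-(a / 6), by omega⟩
    · exact ⟨a / 6 + 1, by omega⟩
  have hi : i = pentagonal k := by
    have hsq : a ^ 2 = (6 * k - 1) ^ 2 := by rcases hk with rfl | rfl <;> ring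
    have := two_mul_natCast_pentagonal k
    zify
    linarith
  rw [hi, coeff_pentagonalSeries_pentagonal]
  congr 1
  rcases Int.even_or_odd k with he | ho
  · rw [Int.negOnePow_even k he, twelveSign, if_pos]
    · simp
    · obtain ⟨r, rfl⟩ := he
      omega
  · rw [Int.negOnePow_odd k ho, twelveSign, if_neg]
    · simp
    · obtain ⟨r, rfl⟩ := ho
      omega

theorem coeff_expand_pentagonalSeries_of_sq (R : Type*) [CommRing R] {m : ℕ} (hm : m ≠ 0)
    {i : ℕ} {a : ℤ} (h : 24 * (i : ℤ) + m = m * a ^ 2) (hmc : m.Coprime 24) :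
    (expand m hm (pentagonalSeries R)).coeff i = twelveSign a := by
  obtain ⟨j, rfl⟩ : m ∣ i := by
    refine hmc.dvd_of_dvd_mul_left ?_
    zify
    exact ⟨a ^ 2 - 1, by linarith⟩
  rw [coeff_expand_mul]
  apply coeff_pentagonalSeries_of_sq
  have : (m : ℤ) ≠ 0 := by exact_mod_cast hm
  apply mul_left_cancel₀ this
  push_cast at h
  linarith

theorem exists_sq_of_coeff_mul_ne_zero {R : Type*} [CommRing R] {m : ℕ} (hm : m ≠ 0)
    {i j : ℕ} (h : (pentagonalSeries R).coeff i *
      (expand m hm (pentagonalSeries R)).coeff j ≠ 0) :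
    ∃ x y : ℤ, 24 * (i : ℤ) + 1 = x ^ 2 ∧ 24 * (j : ℤ) + m = m * y ^ 2 := by
  obtain ⟨x, hx⟩ := exists_sq_of_coeff_pentagonalSeries_ne_zero (left_ne_zero_of_mul h)
  have hj := right_ne_zero_of_mul h
  rw [coeff_expand] at hj
  split_ifs at hj with hd
  · obtain ⟨j, rfl⟩ := hd
    rw [Nat.mul_div_cancel_left _ (Nat.pos_of_ne_zero hm)] at hj
    obtain ⟨y, hy⟩ := exists_sq_of_coeff_pentagonalSeries_ne_zero hj
    exact ⟨x, y, hx, by push_cast; linear_combination (m : ℤ) * hy⟩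
  · exact absurd rfl hj

theorem dvd_of_dvd_sq_add_mul_sq {p : ℕ} [Fact p.Prime] {d : ℤ}
    (hd : ¬ IsSquare (-d : ZMod p)) {x y : ℤ} (h : (p : ℤ) ∣ x ^ 2 + d * y ^ 2) :
    (p : ℤ) ∣ x ∧ (p : ℤ) ∣ y := by
  simp only [← ZMod.intCast_zmod_eq_zero_iff_dvd] at *
  push_cast at h
  have hy : (y : ZMod p) = 0 := by
    by_contra hy
    refine hd ⟨x / y, ?_⟩
    field_simp
    linear_combination -h
  exact ⟨by simpa [hy] using h, hy⟩

theorem sq_add_mul_sq_ne_pow_odd_mul {p : ℕ} [Fact p.Prime] {d : ℤ}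
    (hd : ¬ IsSquare (-d : ZMod p)) {m : ℤ} (hm : ¬ (p : ℤ) ∣ m) (a : ℕ) (x y : ℤ) :
    x ^ 2 + d * y ^ 2 ≠ p ^ (2 * a + 1) * m := by
  have hp0 : (p : ℤ) ≠ 0 := by exact_mod_cast (Fact.out : p.Prime).ne_zero
  induction a generalizing x y with
  | zero =>
    intro h
    obtain ⟨⟨x, rfl⟩, ⟨y, rfl⟩⟩ :=
      dvd_of_dvd_sq_add_mul_sq hd (x := x) (y := y) ⟨m, by rw [h]; ring⟩
    refine hm ⟨x ^ 2 + d * y ^ 2, mul_left_cancel₀ hp0 ?_⟩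
    linear_combination -h
  | succ a ih =>
    intro h
    obtain ⟨⟨x, rfl⟩, ⟨y, rfl⟩⟩ :=
      dvd_of_dvd_sq_add_mul_sq hd (x := x) (y := y) ⟨p ^ (2 * a + 2) * m, by rw [h]; ring⟩
    refine ih x y (mul_left_cancel₀ (pow_ne_zero 2 hp0) ?_)
    linear_combination h

/-- **Thue's lemma**. -/
theorem exists_small_dvd_sub_mul {p : ℕ} (hp : p.Prime) (t : ℤ) :
    ∃ x y : ℤ, (x ≠ 0 ∨ y ≠ 0) ∧ x ^ 2 < p ∧ y ^ 2 < p ∧ (p : ℤ) ∣ x - t * y := by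
  have : NeZero p := ⟨hp.ne_zero⟩
  set s := Nat.sqrt p
  have hs : (s : ℤ) ^ 2 < p := by
    have h1 : s ^ 2 ≤ p := Nat.sqrt_le' p
    have h2 : s ^ 2 ≠ p := by
      intro h
      rw [← h] at hp
      exact Nat.Prime.not_prime_pow le_rfl hp
    exact_mod_cast lt_of_le_of_ne h1 h2
  let f : Fin (s + 1) × Fin (s + 1) → ZMod p := fun z ↦ (z.1 : ℕ) - t * (z.2 : ℕ)
  obtain ⟨z, w, hne, heq⟩ := Fintype.exists_ne_map_eq_of_card_lt f (by
    simpa [ZMod.card, ← pow_two] using Nat.lt_succ_sqrt' p)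
  have small (a b : Fin (s + 1)) : (((a : ℕ) : ℤ) - ((b : ℕ) : ℤ)) ^ 2 < p := by
    refine lt_of_le_of_lt (sq_le_sq' ?_ ?_) hs <;> omega
  refine ⟨(z.1 : ℕ) - (w.1 : ℕ), (z.2 : ℕ) - (w.2 : ℕ), ?_, small _ _, small _ _, ?_⟩
  · contrapose! hne
    ext <;> omega
  · rw [← ZMod.intCast_zmod_eq_zero_iff_dvd]
    push_cast
    simp only [f] at heq
    linear_combination heq

theorem exists_eq_sq_add_five_mul_sq {p : ℕ} [hp : Fact p.Prime] (hp1 : p % 4 = 1)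
    (h : IsSquare (-5 : ZMod p)) : ∃ u v : ℤ, (p : ℤ) = u ^ 2 + 5 * v ^ 2 := by
  obtain ⟨t, ht⟩ := h
  obtain ⟨x, y, hne, hx, hy, hd⟩ := exists_small_dvd_sub_mul hp.out (t.val : ℤ)
  obtain ⟨k, hk⟩ : (p : ℤ) ∣ x ^ 2 + 5 * y ^ 2 := by
    rw [← ZMod.intCast_zmod_eq_zero_iff_dvd] at hd ⊢
    push_cast at hd ⊢
    rw [ZMod.natCast_zmod_val] at hd
    linear_combination (x + t * y) * hd - (y : ZMod p) ^ 2 * ht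
  have hpos : 0 < x ^ 2 + 5 * y ^ 2 := by
    rcases hne with h | h
    · nlinarith [sq_nonneg y, pow_pos (abs_pos.2 h) 2, sq_abs x]
    · nlinarith [sq_nonneg x, pow_pos (abs_pos.2 h) 2, sq_abs y]
  have hk0 : 0 < k := by nlinarith
  have hk6 : k < 6 := by nlinarith
  have hp4 : (p : ℤ) % 4 = 1 := by omega
  have m8 (z : ℤ) : z ^ 2 % 8 = 0 ∧ z % 2 = 0 ∨ z ^ 2 % 8 = 1 ∧ z % 2 = 1 ∨
      z ^ 2 % 8 = 4 ∧ z % 2 = 0 := by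
    have : z % 8 = 0 ∨ z % 8 = 1 ∨ z % 8 = 2 ∨ z % 8 = 3 ∨ z % 8 = 4 ∨ z % 8 = 5 ∨ z % 8 = 6 ∨
      z % 8 = 7 := by omega
    rcases this with h | h | h | h | h | h | h | h <;> simp [pow_two, Int.mul_emod, h] <;> omega
  have hx8 := m8 x
  have hy8 := m8 y
  interval_cases k
  · exact ⟨x, y, by linarith⟩
  · omega
  · omega
  · obtain ⟨a, rfl⟩ : 2 ∣ x := by omega
    obtain ⟨b, rfl⟩ : 2 ∣ y := by omega
    exact ⟨a, b, by linarith⟩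
  · obtain ⟨a, rfl⟩ : (5 : ℤ) ∣ x :=
      (Nat.prime_iff_prime_int.1 Nat.prime_five).dvd_of_dvd_pow (n := 2)
        ⟨p - y ^ 2, by push_cast; linarith⟩
    exact ⟨y, a, by linarith⟩

theorem sq_eq_of_sq_add_five_mul_sq_eq {p : ℕ} (hp : p.Prime) {u v x y : ℤ}
    (hp' : (p : ℤ) = u ^ 2 + 5 * v ^ 2) (h : x ^ 2 + 5 * y ^ 2 = 6 * p) :
    x ^ 2 = (u + 5 * v) ^ 2 ∨ x ^ 2 = (u - 5 * v) ^ 2 := by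
  have hp0 : (p : ℤ) ≠ 0 := by exact_mod_cast hp.ne_zero
  have key (y : ℤ) (h : x ^ 2 + 5 * y ^ 2 = 6 * p) (hd : (p : ℤ) ∣ x * v - y * u) :
      x ^ 2 = (u + 5 * v) ^ 2 ∨ x ^ 2 = (u - 5 * v) ^ 2 := by
    obtain ⟨s, hs⟩ := hd
    obtain ⟨r, hr⟩ : (p : ℤ) ∣ x * u + 5 * y * v := by
      refine (Nat.prime_iff_prime_int.1 hp).dvd_of_dvd_pow (n := 2) ⟨6 * p - 5 * p * s ^ 2, ?_⟩
      linear_combination (u ^ 2 + 5 * v ^ 2) * h - 6 * p * hp' -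
        5 * (x * v - y * u + p * s) * hs
    have hrs : r ^ 2 + 5 * s ^ 2 = 6 := by
      apply mul_left_cancel₀ (pow_ne_zero 2 hp0)
      linear_combination (u ^ 2 + 5 * v ^ 2) * h - 6 * p * hp' -
        5 * (x * v - y * u + p * s) * hs - (x * u + 5 * y * v + p * r) * hr
    have hx : x = u * r + 5 * v * s := by
      apply mul_left_cancel₀ hp0
      linear_combination x * hp' + u * hr + 5 * v * hs
    have hs1 : s ^ 2 = 1 := by
      have : s < 2 := by nlinarith [sq_nonneg r]
      have : -2 < s := by nlinarith [sq_nonneg r]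
      have : r < 3 := by nlinarith [sq_nonneg s]
      have : -3 < r := by nlinarith [sq_nonneg s]
      interval_cases s <;> interval_cases r <;> omega
    have hr1 : r ^ 2 = 1 := by linarith
    rcases mul_self_eq_one_iff.1 ((pow_two s).symm.trans hs1) with rfl | rfl <;>
      rcases mul_self_eq_one_iff.1 ((pow_two r).symm.trans hr1) with rfl | rfl <;> subst hx
    · left; ring
    · right; ring
    · right; ring
    · left; ring
  have hmul : (p : ℤ) ∣ (x * v - y * u) * (x * v - -y * u) :=
    ⟨6 * v ^ 2 - y ^ 2, by linear_combination v ^ 2 * h + y ^ 2 * hp'⟩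
  rcases (Nat.prime_iff_prime_int.1 hp).dvd_or_dvd hmul with hd | hd
  · exact key y h hd
  · exact key (-y) (by linarith) hd

theorem twelveSign_congr {a b : ℤ} (h : a ≡ b [ZMOD 12]) : twelveSign a = twelveSign b := by
  simp only [twelveSign, h.eq]

theorem isUnit_twelveSign (a : ℤ) : IsUnit (twelveSign a) := by
  unfold twelveSign
  split_ifs <;> simp

theorem twelveSign_mul_twelveSign_eq {u v : ℤ} (h4 : (u ^ 2 + 5 * v ^ 2) % 4 = 1)
    (h3 : (u ^ 2 + 5 * v ^ 2) % 3 ≠ 0) :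
    twelveSign (u + 5 * v) * twelveSign (u - v) =
      twelveSign (u - 5 * v) * twelveSign (u + v) := by
  have key : ∀ a b : Fin 12, (((a : ℕ) : ℤ) ^ 2 + 5 * ((b : ℕ) : ℤ) ^ 2) % 4 = 1 →
      (((a : ℕ) : ℤ) ^ 2 + 5 * ((b : ℕ) : ℤ) ^ 2) % 3 ≠ 0 →
      twelveSign (((a : ℕ) : ℤ) + 5 * ((b : ℕ) : ℤ)) * twelveSign (((a : ℕ) : ℤ) - ((b : ℕ) : ℤ)) =
      twelveSign (((a : ℕ) : ℤ) - 5 * ((b : ℕ) : ℤ)) *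
        twelveSign (((a : ℕ) : ℤ) + ((b : ℕ) : ℤ)) := by
    unfold twelveSign
    decide
  have lift (z : ℤ) : ∃ a : Fin 12, z ≡ ((a : ℕ) : ℤ) [ZMOD 12] := by
    refine ⟨⟨(z % 12).toNat, by omega⟩, ?_⟩
    rw [Int.ModEq]
    simp only
    omega
  obtain ⟨a, ha⟩ := lift u
  obtain ⟨b, hb⟩ := lift v
  have hab := (ha.pow 2).add ((hb.pow 2).mul_left 5)
  rw [twelveSign_congr (ha.add (hb.mul_left 5)), twelveSign_congr (ha.sub hb),
    twelveSign_congr (ha.sub (hb.mul_left 5)), twelveSign_congr (ha.add hb)]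
  refine key a b ?_ ?_
  · rw [← h4]
    exact (hab.of_dvd (by norm_num)).symm
  · rwa [← (hab.of_dvd (by norm_num) : _ ≡ _ [ZMOD 3]).eq]

theorem exists_natCast_eq_of_odd_of_not_three_dvd {a : ℤ} (h2 : a % 2 = 1) (h3 : a % 3 ≠ 0) :
    ∃ i : ℕ, 24 * (i : ℤ) + 1 = a ^ 2 := by
  have h : a ^ 2 % 24 = 1 := by
    have : a % 24 = 1 ∨ a % 24 = 5 ∨ a % 24 = 7 ∨ a % 24 = 11 ∨ a % 24 = 13 ∨ a % 24 = 17 ∨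
      a % 24 = 19 ∨ a % 24 = 23 := by omega
    rcases this with h | h | h | h | h | h | h | h <;> simp [pow_two, Int.mul_emod, h]
  have := sq_nonneg a
  exact ⟨(a ^ 2 / 24).toNat, by omega⟩

theorem coeff_pentagonalSeries_mul_expand_five_ne_zero {p N : ℕ} [hp : Fact p.Prime]
    (hN : 4 * N + 1 = p) (h : IsSquare (-5 : ZMod p)) :
    coeff N (pentagonalSeries (ZMod 3) * expand 5 (by norm_num) (pentagonalSeries (ZMod 3))) ≠
      0 := by
  obtain ⟨u, v, huv⟩ := exists_eq_sq_add_five_mul_sq (by omega) h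
  have hN' : 4 * (N : ℤ) + 1 = p := by exact_mod_cast hN
  have h4 : (u ^ 2 + 5 * v ^ 2) % 4 = 1 := by omega
  have h3 : (u ^ 2 + 5 * v ^ 2) % 3 ≠ 0 := by
    intro h0
    have h3p : 3 ∣ p := by omega
    rw [Nat.prime_dvd_prime_iff_eq Nat.prime_three hp.out] at h3p
    omega
  have odd_sub : (u - v) % 2 = 1 := by
    rcases Int.emod_two_eq_zero_or_one (u - v) with h0 | h0
    · obtain ⟨w, hw⟩ := Int.dvd_of_emod_eq_zero h0
      obtain rfl : u = v + 2 * w := by omega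
      ring_nf at h4
      omega
    · exact h0
  have three_sub : (u - v) % 3 ≠ 0 := by
    intro h0
    obtain ⟨w, hw⟩ := Int.dvd_of_emod_eq_zero h0
    obtain rfl : u = v + 3 * w := by omega
    ring_nf at h3
    omega
  have three_add : (u + v) % 3 ≠ 0 := by
    intro h0
    obtain ⟨w, hw⟩ := Int.dvd_of_emod_eq_zero h0
    obtain rfl : u = 3 * w - v := by omega
    ring_nf at h3
    omega
  obtain ⟨i₁, hi₁⟩ := exists_natCast_eq_of_odd_of_not_three_dvd
    (a := u + 5 * v) (by omega) (by omega)
  obtain ⟨j₁, hj₁⟩ := exists_natCast_eq_of_odd_of_not_three_dvd (a := u - v) odd_sub three_sub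
  obtain ⟨i₂, hi₂⟩ := exists_natCast_eq_of_odd_of_not_three_dvd
    (a := u - 5 * v) (by omega) (by omega)
  obtain ⟨j₂, hj₂⟩ := exists_natCast_eq_of_odd_of_not_three_dvd
    (a := u + v) (by omega) three_add
  have hs₁ : i₁ + 5 * j₁ = N := by
    zify
    linarith
  have hs₂ : i₂ + 5 * j₂ = N := by
    zify
    linarith
  rw [coeff_mul, ← Finset.sum_subset (s₁ := {(i₁, 5 * j₁), (i₂, 5 * j₂)})]
  · have e₁ := coeff_pentagonalSeries_of_sq (ZMod 3) hi₁
    have e₂ := coeff_pentagonalSeries_of_sq (ZMod 3) hi₂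
    have f₁ := coeff_pentagonalSeries_of_sq (ZMod 3) hj₁
    have f₂ := coeff_pentagonalSeries_of_sq (ZMod 3) hj₂
    have hprod := twelveSign_mul_twelveSign_eq h4 h3
    have hunit := (isUnit_twelveSign (u - 5 * v)).mul (isUnit_twelveSign (u + v))
    by_cases heq : (i₁, 5 * j₁) = (i₂, 5 * j₂)
    · rw [heq, Finset.pair_eq_singleton, Finset.sum_singleton, coeff_expand_mul, e₂, f₂,
        ← Int.cast_mul]
      rcases Int.isUnit_iff.1 hunit with h | h <;> rw [h] <;> decide
    · rw [Finset.sum_pair heq, coeff_expand_mul, coeff_expand_mul, e₁, f₁, e₂, f₂,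
        ← Int.cast_mul, ← Int.cast_mul, hprod]
      rcases Int.isUnit_iff.1 hunit with h | h <;> rw [h] <;> decide
  · simp [Finset.insert_subset_iff, hs₁, hs₂]
  · rintro ⟨i, j⟩ hij hmem
    contrapose! hmem
    obtain ⟨x, y, hx, hy⟩ := exists_sq_of_coeff_mul_ne_zero _ hmem
    rw [Finset.HasAntidiagonal.mem_antidiagonal] at hij
    have hij' : (i : ℤ) + j = N := by exact_mod_cast hij
    push_cast at hy
    simp only [Finset.mem_insert, Finset.mem_singleton, Prod.mk.injEq]
    rcases sq_eq_of_sq_add_five_mul_sq_eq hp.out huv (x := x) (y := y) (by linarith) with h | h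
    · left; omega
    · right; omega

theorem coeff_pentagonalSeries_mul_expand_five_eq_zero (R : Type*) [CommRing R] {p N m a : ℕ}
    [hp : Fact p.Prime] (h6 : ¬ p ∣ 6) (h : ¬ IsSquare (-5 : ZMod p)) (hm : ¬ p ∣ m)
    (hN : 4 * N + 1 = p ^ (2 * a + 1) * m) :
    coeff N (pentagonalSeries R * expand 5 (by norm_num) (pentagonalSeries R)) = 0 := by
  rw [coeff_mul]
  refine Finset.sum_eq_zero fun ij hij ↦ ?_
  by_contra hne
  obtain ⟨x, y, hx, hy⟩ := exists_sq_of_coeff_mul_ne_zero _ hne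
  rw [Finset.HasAntidiagonal.mem_antidiagonal] at hij
  have hij' : (ij.1 : ℤ) + ij.2 = N := by exact_mod_cast hij
  have hN' : 4 * (N : ℤ) + 1 = p ^ (2 * a + 1) * m := by exact_mod_cast hN
  push_cast at hy
  refine sq_add_mul_sq_ne_pow_odd_mul (p := p) (d := 5) (by exact_mod_cast h) (m := 6 * m) ?_
    a x y (by linarith)
  exact_mod_cast hp.out.not_dvd_mul h6 hm

/-- Theorem 1.4(ii). -/
theorem B_3_5_newman_cong (p : ℕ) (hp : p.Prime) (hp1 : p % 4 = 1)
    (hB : B 3 5 ((p - 1) / 4) ≡ 0 [MOD 3]) (α n : ℕ) (hn : ¬ p ∣ (4 * n + 1)) :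
    B 3 5 (p ^ (2 * α + 1) * n + (p ^ (2 * α + 1) - 1) / 4) ≡ 0 [MOD 3] := by
  have : Fact p.Prime := ⟨hp⟩
  rw [← ZMod.natCast_eq_natCast_iff, cast_B_three 5 _ (by norm_num), Nat.cast_zero] at hB ⊢
  have h5 : ¬ IsSquare (-5 : ZMod p) := fun h ↦
    coeff_pentagonalSeries_mul_expand_five_ne_zero (by omega) h hB
  have h6 : ¬ p ∣ 6 := by
    intro h
    have := Nat.le_of_dvd (by norm_num) h
    interval_cases p <;> revert hp <;> norm_num at *
  refine coeff_pentagonalSeries_mul_expand_five_eq_zero (ZMod 3) h6 h5 hn (a := α) ?_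
  have hpow : p ^ (2 * α + 1) % 4 = 1 := by simp [Nat.pow_mod, hp1]
  rw [mul_add, mul_add, mul_left_comm]
  omega
end
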